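/- Let 0<x<1 be real, s∈ℂ with Re(s)>0, r∈ℂ, r* := r−1, and let n ≥ 1 be an integer. Let u₁,…,u_{n+1} be complex numbers such that [u_k−u_j]_s ≠ 0 and [u_k−u_j+r]_s ≠ 0 for all j ≠ k. Then ∑_{k=1}^{n+1} ∏_{j≠k} ( [u_j−u_k+1]_s [u_j−u_k+r*]_s ) / ( [u_j−u_k]_s [u_j−u_k+r]_s ) = ∑_{k=1}^{n+1} ∏_{j≠k} ( [u_k−u_j+1]_s [u_k−u_j+r*]_s ) / ( [u_k−u_j]_s [u_k−u_j+r]_s ). -/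

import Mathlib

open Complex

/-- `x^w := exp(w · log x)` for real `x` and complex `w`. -/
noncomputable def xpow (x : ℝ) (w : ℂ) : ℂ := Complex.exp (w * (Real.log x : ℂ))

/-- The infinite `q`-Pochhammer product `(z;q)_∞ = ∏_{j=0}^∞ (1 − q^j z)`. -/
noncomputable def qPoch (z q : ℂ) : ℂ := ∏' j : ℕ, (1 - q ^ j * z)

/-- `Θ_q(z) = (z;q)_∞ (q z⁻¹;q)_∞ (q;q)_∞`. -/
noncomputable def jacTheta0 (q z : ℂ) : ℂ := qPoch z q * qPoch (q * z⁻¹) q * qPoch q q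

/-- The Jacobi theta function `[u]_r = x^{u²/r − u} Θ_{x^{2r}}(x^{2u}) / ((x^{2r};x^{2r})_∞)³`. -/
noncomputable def jTheta (x : ℝ) (r u : ℂ) : ℂ :=
  xpow x (u ^ 2 / r - u) * jacTheta0 (xpow x (2 * r)) (xpow x (2 * u)) /
    (qPoch (xpow x (2 * r)) (xpow x (2 * r))) ^ 3

section QPochhammer

variable {q : ℂ}

lemma qPoch_summable_norm (hq : ‖q‖ < 1) (z : ℂ) : Summable fun j : ℕ ↦ ‖-(q ^ j * z)‖ := by
  simpa using (summable_geometric_of_lt_one (norm_nonneg q) hq).mul_right ‖z‖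

lemma qPoch_multipliable (hq : ‖q‖ < 1) (z : ℂ) : Multipliable fun j : ℕ ↦ 1 - q ^ j * z := by
  simpa only [sub_eq_add_neg] using multipliable_one_add_of_summable (qPoch_summable_norm hq z)

lemma qPoch_eq_mul (hq : ‖q‖ < 1) (z : ℂ) : qPoch z q = (1 - z) * qPoch (q * z) q := by
  unfold qPoch
  have h : ∀ j : ℕ, 1 - q ^ j * (q * z) = 1 - q ^ (j + 1) * z := fun j ↦ by ring
  simp only [h]
  rw [tprod_eq_zero_mul' (f := fun j : ℕ ↦ 1 - q ^ j * z)]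
  · simp
  · simpa only [h] using qPoch_multipliable hq (q * z)

lemma exists_of_qPoch_eq_zero (hq : ‖q‖ < 1) {z : ℂ} (hz : qPoch z q = 0) :
    ∃ j : ℕ, q ^ j * z = 1 := by
  by_contra! h
  refine tprod_one_add_ne_zero_of_summable (f := fun j : ℕ ↦ -(q ^ j * z)) (fun j ↦ ?_)
    (qPoch_summable_norm hq z) (by simpa only [← sub_eq_add_neg, qPoch] using hz)
  rw [← sub_eq_add_neg, sub_ne_zero]
  exact (h j).symm

lemma qPoch_self_ne_zero (hq : ‖q‖ < 1) : qPoch q q ≠ 0 := by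
  intro h
  obtain ⟨j, hj⟩ := exists_of_qPoch_eq_zero hq h
  have : ‖q ^ (j + 1)‖ < 1 := by
    rw [norm_pow]
    exact pow_lt_one₀ (norm_nonneg q) hq (by simp)
  rw [pow_succ, hj] at this
  simp at this

lemma differentiable_qPoch (hq : ‖q‖ < 1) : Differentiable ℂ fun z ↦ qPoch z q := by
  intro z
  have hu : Summable fun j : ℕ ↦ ‖q‖ ^ j * (‖z‖ + 1) :=
    (summable_geometric_of_lt_one (norm_nonneg q) hq).mul_right _
  have hprod := hu.hasProdLocallyUniformlyOn_nat_one_add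
    (f := fun (j : ℕ) (w : ℂ) ↦ -(q ^ j * w)) (K := Metric.ball z 1) Metric.isOpen_ball
    (Filter.Eventually.of_forall fun j w hw ↦ by
      rw [norm_neg, norm_mul, norm_pow]
      gcongr
      have := norm_sub_norm_le w z
      rw [Metric.mem_ball, dist_eq_norm] at hw
      linarith)
    (fun j ↦ by fun_prop)
  have hd := hprod.tendstoLocallyUniformlyOn_finsetRange.differentiableOn
    (Filter.Eventually.of_forall fun N ↦ by fun_prop) Metric.isOpen_ball
  simp only [← sub_eq_add_neg] at hd
  exact hd.differentiableAt (Metric.ball_mem_nhds z one_pos)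

lemma jacTheta0_mul_left (hq : ‖q‖ < 1) (hq0 : q ≠ 0) {w : ℂ} (hw : w ≠ 0) :
    jacTheta0 q (q * w) = -w⁻¹ * jacTheta0 q w := by
  unfold jacTheta0
  have h1 : q * (q * w)⁻¹ = w⁻¹ := by field_simp
  rw [h1, qPoch_eq_mul hq w⁻¹, qPoch_eq_mul hq w]
  field_simp
  ring

lemma jacTheta0_inv (hq : ‖q‖ < 1) {w : ℂ} (hw : w ≠ 0) :
    jacTheta0 q w⁻¹ = -w⁻¹ * jacTheta0 q w := by
  unfold jacTheta0
  rw [inv_inv, qPoch_eq_mul hq w⁻¹, qPoch_eq_mul hq w]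
  field_simp
  ring

lemma exists_zpow_of_jacTheta0_eq_zero (hq : ‖q‖ < 1) {w : ℂ} (hw : w ≠ 0)
    (h : jacTheta0 q w = 0) : ∃ k : ℤ, w = q ^ k := by
  simp only [jacTheta0, mul_eq_zero, qPoch_self_ne_zero hq, or_false] at h
  rcases h with h | h
  · obtain ⟨j, hj⟩ := exists_of_qPoch_eq_zero hq h
    exact ⟨-j, by rw [zpow_neg, zpow_natCast]; exact eq_inv_of_mul_eq_one_right hj⟩
  · obtain ⟨j, hj⟩ := exists_of_qPoch_eq_zero hq h
    refine ⟨(j + 1 : ℕ), ?_⟩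
    rw [zpow_natCast, pow_succ]
    field_simp at hj
    exact hj.symm

end QPochhammer

/-- An odd entire function with a simple zero at the origin, whose zeros are quasi-periods and
include two real-linearly independent ones. -/
structure IsThetaFunction (T : ℂ → ℂ) : Prop where
  differentiable : Differentiable ℂ T
  odd : ∀ u, T (-u) = -T u
  deriv_zero_ne : deriv T 0 ≠ 0
  quasiperiod : ∀ l, T l = 0 → ∃ c d : ℂ, ∀ u, T (u + l) = exp (c * u + d) * T u
  spanning : ∃ a b : ℂ, (∀ k m : ℤ, T (k * a + m * b) = 0) ∧
    ∀ z : ℂ, ∃ α β : ℝ, z = α * a + β * b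

open Filter Topology

/-- An entire function divided by an entire function with only simple zeros, all of them shared,
is entire. -/
lemma exists_entire_quotient {F G : ℂ → ℂ} (hF : Differentiable ℂ F) (hG : Differentiable ℂ G)
    (h : ∀ p, G p = 0 → deriv G p ≠ 0 ∧ F p = 0) :
    ∃ H : ℂ → ℂ, Differentiable ℂ H ∧ ∀ z, F z = H z * G z := by
  classical
  refine ⟨fun z ↦ if G z = 0 then deriv F z / deriv G z else F z / G z, fun p ↦ ?_, fun z ↦ ?_⟩
  · by_cases hp : G p = 0
    · obtain ⟨hd, hFp⟩ := h p hp
      have diff : ∀ {K : ℂ → ℂ}, Differentiable ℂ K → DifferentiableAt ℂ (dslope K p) p :=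
        fun hK ↦ ((Complex.differentiableOn_dslope (s := Set.univ) univ_mem).2
          hK.differentiableOn).differentiableAt univ_mem
      have hG0 : dslope G p p ≠ 0 := by rwa [dslope_same]
      refine ((diff hF).div (diff hG) hG0).congr_of_eventuallyEq ?_
      filter_upwards [(diff hG).continuousAt.eventually_ne hG0] with z hz
      by_cases hzp : z = p
      · subst hzp
        simp [hp]
      · have key : ∀ K : ℂ → ℂ, K p = 0 → K z = (z - p) * dslope K p z := fun K hK ↦ by
          have := sub_smul_dslope K p z
          rw [hK, sub_zero, smul_eq_mul] at this
          exact this.symm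
        have hsub := sub_ne_zero.2 hzp
        have hGz : G z ≠ 0 := by
          rw [key G hp]
          exact mul_ne_zero hsub hz
        rw [if_neg hGz, key F hFp, key G hp, mul_div_mul_left _ _ hsub]
        rfl
    · refine ((hF p).div (hG p) hp).congr_of_eventuallyEq ?_
      filter_upwards [(hG p).continuousAt.eventually_ne hp] with z hz
      simp [hz]
  · by_cases hz : G z = 0
    · simp [hz, (h z hz).2]
    · simp [hz]

/-- A continuous function vanishing on punctured neighbourhoods of a point vanishes there. -/
lemma eq_zero_of_eventually_punctured {f : ℂ → ℂ} {p : ℂ} (hf : ContinuousAt f p)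
    (h : ∀ᶠ z in 𝓝[≠] p, f z = 0) : f p = 0 := by
  refine tendsto_nhds_unique (hf.tendsto.mono_left (nhdsWithin_le_nhds (s := {p}ᶜ))) ?_
  exact tendsto_const_nhds.congr' (h.mono fun z hz ↦ hz.symm)

/-- An entire doubly periodic function is constant. -/
lemma eq_of_doubly_periodic {H : ℂ → ℂ} (hH : Differentiable ℂ H) {a b : ℂ}
    (hper : ∀ (k m : ℤ) z, H (z + (k * a + m * b)) = H z)
    (hspan : ∀ z : ℂ, ∃ α β : ℝ, z = α * a + β * b) (z w : ℂ) : H z = H w := by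
  refine hH.apply_eq_apply_of_bounded ?_ z w
  have hc : IsCompact ((fun p : ℝ × ℝ ↦ H (p.1 * a + p.2 * b)) ''
      (Set.Icc 0 1 ×ˢ Set.Icc 0 1)) := by
    refine (isCompact_Icc.prod isCompact_Icc).image ?_
    have := hH.continuous
    fun_prop
  refine hc.isBounded.subset ?_
  rintro _ ⟨z, rfl⟩
  obtain ⟨α, β, rfl⟩ := hspan z
  refine ⟨(Int.fract α, Int.fract β), ⟨⟨Int.fract_nonneg _, (Int.fract_lt_one _).le⟩,
    ⟨Int.fract_nonneg _, (Int.fract_lt_one _).le⟩⟩, ?_⟩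
  have hα : (α : ℂ) = Int.fract α + ⌊α⌋ := by exact_mod_cast (Int.fract_add_floor α).symm
  have hβ : (β : ℂ) = Int.fract β + ⌊β⌋ := by exact_mod_cast (Int.fract_add_floor β).symm
  simp only []
  rw [← hper ⌊α⌋ ⌊β⌋]
  congr 1
  linear_combination (-a) * hα - b * hβ

namespace IsThetaFunction

variable {T : ℂ → ℂ} (hT : IsThetaFunction T)
include hT

lemma map_zero : T 0 = 0 := by
  have := hT.odd 0
  rw [neg_zero] at this
  exact self_eq_neg.1 this

lemma map_sub_comm (u v : ℂ) : T (u - v) = -T (v - u) := by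
  rw [← hT.odd, neg_sub]

lemma deriv_ne_zero {p : ℂ} (hp : T p = 0) : deriv T p ≠ 0 := by
  obtain ⟨c, d, h⟩ := hT.quasiperiod p hp
  have h0 : HasDerivAt (fun u ↦ T (u + p)) (deriv T p) 0 := by
    have := (hT.differentiable (0 + p)).hasDerivAt.comp_add_const 0 p
    rwa [zero_add] at this
  have h1 : HasDerivAt (fun u : ℂ ↦ exp (c * u + d)) (exp (c * 0 + d) * (c * 1)) 0 :=
    (((hasDerivAt_id (0 : ℂ)).const_mul c).add_const d).cexp
  have h2 := h1.mul (hT.differentiable 0).hasDerivAt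
  have h3 : (fun u ↦ T (u + p)) = (fun u : ℂ ↦ exp (c * u + d)) * T := funext h
  rw [h3] at h0
  rw [h0.unique h2, hT.map_zero, mul_zero, zero_add]
  exact mul_ne_zero (exp_ne_zero _) hT.deriv_zero_ne

lemma eventually_ne_zero (p : ℂ) : ∀ᶠ z in 𝓝[≠] p, T z ≠ 0 := by
  by_cases hp : T p = 0
  · exact (hT.differentiable p).hasDerivAt.eventually_ne (hT.deriv_ne_zero hp)
  · exact ((hT.differentiable p).continuousAt.eventually_ne hp).filter_mono nhdsWithin_le_nhds

lemma eventually_affine_ne_zero {c : ℂ} (hc : c ≠ 0) (d p : ℂ) :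
    ∀ᶠ z in 𝓝[≠] p, T (d + c * z) ≠ 0 := by
  suffices h : Tendsto (fun z ↦ d + c * z) (𝓝[≠] p) (𝓝[≠] (d + c * p)) from
    h.eventually (hT.eventually_ne_zero (d + c * p))
  refine tendsto_nhdsWithin_of_tendsto_nhds_of_eventually_within _ ?_ ?_
  · exact (Continuous.tendsto (by fun_prop) p).mono_left nhdsWithin_le_nhds
  · filter_upwards [self_mem_nhdsWithin] with z hz h
    exact hz (mul_left_cancel₀ hc (add_left_cancel h))

lemma map_add_eq_zero {u l : ℂ} (hu : T u = 0) (hl : T l = 0) : T (u + l) = 0 := by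
  obtain ⟨c, d, h⟩ := hT.quasiperiod l hl
  rw [h, hu, mul_zero]

lemma quasiperiod_mul {l : ℂ} (hl : T l = 0) : ∃ c d : ℂ, ∀ u v,
    T (u + l + v) * T (u + l - v) = exp (c * u + d) * (T (u + v) * T (u - v)) := by
  obtain ⟨c, d, h⟩ := hT.quasiperiod l hl
  refine ⟨2 * c, 2 * d, fun u v ↦ ?_⟩
  rw [add_right_comm, add_sub_right_comm, h, h, mul_mul_mul_comm, ← exp_add]
  ring_nf

/-- The Weierstrass–Fay identity at arguments in general position. -/
lemma three_term_of_ne {x y z w : ℂ} (h2 : T (y + y) ≠ 0) (hz1 : T (z + y) ≠ 0)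
    (hz2 : T (z - y) ≠ 0) :
    T (x + y) * T (x - y) * (T (z + w) * T (z - w)) +
      T (x + z) * T (x - z) * (T (w + y) * T (w - y)) +
      T (x + w) * T (x - w) * (T (y + z) * T (y - z)) = 0 := by
  have hTd := hT.differentiable
  set F : ℂ → ℂ := fun x ↦ T (x + y) * T (x - y) * (T (z + w) * T (z - w)) +
      T (x + z) * T (x - z) * (T (w + y) * T (w - y)) +
      T (x + w) * T (x - w) * (T (y + z) * T (y - z)) with hF
  set G : ℂ → ℂ := fun x ↦ T (x + y) * T (x - y) with hG
  have hFd : Differentiable ℂ F := by fun_prop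
  have hGd : Differentiable ℂ G := by fun_prop
  have hquasi : ∀ l, T l = 0 → ∃ e : ℂ → ℂ, (∀ u, e u ≠ 0) ∧ (∀ u, F (u + l) = e u * F u) ∧
      ∀ u, G (u + l) = e u * G u := by
    intro l hl
    obtain ⟨c, d, h⟩ := hT.quasiperiod_mul hl
    refine ⟨fun u ↦ exp (c * u + d), fun u ↦ exp_ne_zero _, fun u ↦ ?_, fun u ↦ h u y⟩
    simp only [hF, h]
    ring
  have hFy : F y = 0 := by
    simp only [hF, sub_self, hT.map_zero]
    rw [hT.map_sub_comm w y, add_comm w y]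
    ring
  have hFy' : F (-y) = 0 := by
    simp only [hF, neg_add_cancel, hT.map_zero]
    rw [show -y + z = -(y - z) by ring, show -y - z = -(y + z) by ring,
      show -y + w = w - y by ring, show -y - w = -(w + y) by ring]
    simp only [hT.odd]
    ring
  have hFz : F z = 0 := by
    simp only [hF, sub_self, hT.map_zero]
    rw [hT.map_sub_comm y z, add_comm y z]
    ring
  have hGz : G z ≠ 0 := mul_ne_zero hz1 hz2
  obtain ⟨H, hHd, hH⟩ := exists_entire_quotient hFd hGd fun p hp ↦ by
    have hder : deriv G p = deriv T (p + y) * T (p - y) + T (p + y) * deriv T (p - y) :=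
      (((hTd (p + y)).hasDerivAt.comp_add_const p y).mul
        ((hTd (p - y)).hasDerivAt.comp_sub_const p y)).deriv
    by_cases h1 : T (p + y) = 0
    · have h3 : T (p - y) ≠ 0 := fun h3 ↦ h2 <| by
        have h4 : T (y - p) = 0 := by rw [hT.map_sub_comm, h3, neg_zero]
        have := hT.map_add_eq_zero h1 h4
        rwa [show p + y + (y - p) = y + y by ring] at this
      refine ⟨by simpa [hder, h1, h3] using hT.deriv_ne_zero h1, ?_⟩
      obtain ⟨e, -, he, -⟩ := hquasi _ h1
      have := he (-y)
      rwa [hFy', mul_zero, show -y + (p + y) = p by ring] at this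
    · have h3 : T (p - y) = 0 := (mul_eq_zero.1 hp).resolve_left h1
      refine ⟨by simpa [hder, h1, h3] using hT.deriv_ne_zero h3, ?_⟩
      obtain ⟨e, -, he, -⟩ := hquasi _ h3
      have := he y
      rwa [hFy, mul_zero, show y + (p - y) = p by ring] at this
  have hGne : ∀ p, ∀ᶠ u in 𝓝[≠] p, G u ≠ 0 := fun p ↦ by
    filter_upwards [hT.eventually_affine_ne_zero one_ne_zero y p,
      hT.eventually_affine_ne_zero one_ne_zero (-y) p] with u hu hu'
    refine mul_ne_zero ?_ ?_
    · rwa [one_mul, add_comm] at hu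
    · rwa [one_mul, neg_add_eq_sub] at hu'
  obtain ⟨a, b, hlat, hspan⟩ := hT.spanning
  have hHc : ∀ v, H v = H z := by
    refine fun v ↦ eq_of_doubly_periodic hHd (fun k m p ↦ ?_) hspan v z
    obtain ⟨e, he0, heF, heG⟩ := hquasi _ (hlat k m)
    refine sub_eq_zero.1 (eq_zero_of_eventually_punctured
      (f := fun u ↦ H (u + (k * a + m * b)) - H u) ?_ ?_)
    · have := hHd.continuous
      exact Continuous.continuousAt (by fun_prop)
    · filter_upwards [hGne p] with u hu
      have h5 := hH (u + (k * a + m * b))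
      rw [heF, heG, hH u] at h5
      have h6 : e u * G u * (H (u + (k * a + m * b)) - H u) = 0 := by linear_combination -h5
      exact (mul_eq_zero.1 h6).resolve_left (mul_ne_zero (he0 u) hu)
  have hHz : H z = 0 := by
    have := hH z
    rw [hFz] at this
    exact (mul_eq_zero.1 this.symm).resolve_right hGz
  have := hH x
  rw [hHc x, hHz, zero_mul] at this
  exact this

/-- The Weierstrass–Fay three-term identity. -/
lemma three_term (x y z w : ℂ) :
    T (x + y) * T (x - y) * (T (z + w) * T (z - w)) +
      T (x + z) * T (x - z) * (T (w + y) * T (w - y)) +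
      T (x + w) * T (x - w) * (T (y + z) * T (y - z)) = 0 := by
  have hc := hT.differentiable.continuous
  refine eq_zero_of_eventually_punctured
    (f := fun y ↦ T (x + y) * T (x - y) * (T (z + w) * T (z - w)) +
      T (x + z) * T (x - z) * (T (w + y) * T (w - y)) +
      T (x + w) * T (x - w) * (T (y + z) * T (y - z)))
    (Continuous.continuousAt (by fun_prop)) ?_
  filter_upwards [hT.eventually_affine_ne_zero two_ne_zero 0 y,
    hT.eventually_affine_ne_zero one_ne_zero z y,
    hT.eventually_affine_ne_zero (neg_ne_zero.2 one_ne_zero) z y] with v h1 h2 h3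
  refine hT.three_term_of_ne ?_ ?_ ?_
  · rwa [zero_add, two_mul] at h1
  · rwa [one_mul] at h2
  · rwa [neg_one_mul, ← sub_eq_add_neg] at h3

end IsThetaFunction

namespace IsThetaFunction

variable {T : ℂ → ℂ} (hT : IsThetaFunction T) {ι : Type*} [DecidableEq ι]

lemma sum_map_sub_mul_div_prod_erase {S : Finset ι} {p : ι} (hT0 : T 0 = 0) (hp : p ∈ S)
    {b : ι → ℂ} (hb : ∀ k ∈ S, k ≠ p → T (b k - b p) ≠ 0) (X : ι → ℂ) :
    ∑ k ∈ S, T (b k - b p) * X k / ∏ j ∈ S.erase k, T (b k - b j) =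
      ∑ k ∈ S.erase p, X k / ∏ j ∈ (S.erase p).erase k, T (b k - b j) := by
  rw [← Finset.add_sum_erase S _ hp]
  simp only [sub_self, hT0, zero_mul, zero_div, zero_add]
  refine Finset.sum_congr rfl fun k hk ↦ ?_
  obtain ⟨hkp, hkS⟩ := Finset.mem_erase.1 hk
  rw [Finset.erase_right_comm (a := p),
    ← Finset.mul_prod_erase (S.erase k) _ (Finset.mem_erase.2 ⟨hkp.symm, hp⟩),
    mul_div_mul_left _ _ (hb k hkS hkp)]

include hT

/-- The elliptic partial fraction identity for `n + 2` points. -/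
lemma sum_prod_div_prod_erase_eq_zero (b : ι → ℂ) (n : ℕ) :
    ∀ (S : Finset ι) (a : Multiset ℂ), S.card = n + 2 → a.card = n + 2 →
      a.sum = ∑ k ∈ S, b k → (∀ j ∈ S, ∀ k ∈ S, k ≠ j → T (b k - b j) ≠ 0) →
      ∑ k ∈ S, (a.map fun c ↦ T (b k - c)).prod / ∏ j ∈ S.erase k, T (b k - b j) = 0 := by
  induction n with
  | zero =>
    intro S a hS ha hsum hb
    obtain ⟨p, q, hpq, rfl⟩ := Finset.card_eq_two.1 hS
    obtain ⟨c, d, rfl⟩ := Multiset.card_eq_two.1 ha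
    have h1 : ({p, q} : Finset ι).erase p = {q} := by
      ext k; simp only [Finset.mem_erase, Finset.mem_insert, Finset.mem_singleton]; grind
    have h2 : ({p, q} : Finset ι).erase q = {p} := by
      ext k; simp only [Finset.mem_erase, Finset.mem_insert, Finset.mem_singleton]; grind
    rw [Finset.sum_pair hpq] at hsum ⊢
    simp only [h1, h2, Finset.prod_singleton, Multiset.insert_eq_cons, Multiset.map_cons,
      Multiset.map_singleton, Multiset.prod_cons, Multiset.prod_singleton, Multiset.sum_cons,
      Multiset.sum_singleton] at hsum ⊢
    rw [hT.map_sub_comm (b q) (b p), show b q - c = -(b p - d) by linear_combination -hsum,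
      show b q - d = -(b p - c) by linear_combination -hsum, hT.odd, hT.odd]
    ring
  | succ n ih =>
    intro S a hS ha hsum hb
    obtain ⟨p, hp, q, hq, hpq⟩ := Finset.one_lt_card.1 (show 1 < S.card by lia)
    obtain ⟨a₁, a', rfl, ha'⟩ := Multiset.card_eq_succ_iff.1 ha
    obtain ⟨a₂, a'', rfl, ha''⟩ := Multiset.card_eq_succ_iff.1 ha'
    obtain ⟨a₃, m, rfl, hm⟩ := Multiset.card_eq_succ_iff.1 ha''
    simp only [Multiset.sum_cons] at hsum
    have generic : ∀ c₁ c₃ : ℂ, c₁ + c₃ = a₁ + a₃ → T (b p + b q - a₂ - c₁) ≠ 0 →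
        ∑ k ∈ S, T (b k - c₁) * T (b k - a₂) * (T (b k - c₃) * (m.map fun c ↦ T (b k - c)).prod) /
          ∏ j ∈ S.erase k, T (b k - b j) = 0 := by
      intro c₁ c₃ hc hE
      have he : T (b p - b q) ≠ 0 := hb q hq p hp hpq
      have reduced : ∀ i ∈ S, ∑ k ∈ S, T (b k - b i) * (T (b k - (c₁ + a₂ - b i)) *
          (T (b k - c₃) * (m.map fun c ↦ T (b k - c)).prod)) /
            ∏ j ∈ S.erase k, T (b k - b j) = 0 := by
        intro i hi
        rw [sum_map_sub_mul_div_prod_erase hT.map_zero hi fun k hk hki ↦ hb i hi k hk hki]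
        have := ih (S.erase i) ((c₁ + a₂ - b i) ::ₘ c₃ ::ₘ m)
          (by rw [Finset.card_erase_of_mem hi]; lia) (by simp [hm])
          (by
            rw [← Finset.add_sum_erase S b hi] at hsum
            simp only [Multiset.sum_cons]
            linear_combination hsum + hc)
          (fun j hj k hk ↦ hb j (Finset.mem_of_mem_erase hj) k (Finset.mem_of_mem_erase hk))
        simpa only [Multiset.map_cons, Multiset.prod_cons] using this
      have split : ∀ z, T (b p + b q - a₂ - c₁) * T (b p - b q) * (T (z - c₁) * T (z - a₂)) =
          -(T (b q - a₂) * T (b q - c₁)) * (T (z - b p) * T (z - (c₁ + a₂ - b p))) +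
          T (b p - a₂) * T (b p - c₁) * (T (z - b q) * T (z - (c₁ + a₂ - b q))) := by
        intro z
        have := hT.three_term (z - (c₁ + a₂) / 2) ((c₁ - a₂) / 2) (b p - (c₁ + a₂) / 2)
          (b q - (c₁ + a₂) / 2)
        ring_nf at this ⊢
        rw [show c₁ - b p = -(b p - c₁) by ring, hT.odd] at this
        ring_nf at this ⊢
        linear_combination this
      refine (mul_eq_zero.1 ?_).resolve_left (mul_ne_zero hE he)
      have h1 := reduced p hp
      have h2 := reduced q hq
      calc _ = -(T (b q - a₂) * T (b q - c₁)) * ∑ k ∈ S, T (b k - b p) *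
              (T (b k - (c₁ + a₂ - b p)) * (T (b k - c₃) * (m.map fun c ↦ T (b k - c)).prod)) /
              ∏ j ∈ S.erase k, T (b k - b j) +
            T (b p - a₂) * T (b p - c₁) * ∑ k ∈ S, T (b k - b q) *
              (T (b k - (c₁ + a₂ - b q)) * (T (b k - c₃) * (m.map fun c ↦ T (b k - c)).prod)) /
              ∏ j ∈ S.erase k, T (b k - b j) := by
            rw [Finset.mul_sum, Finset.mul_sum, Finset.mul_sum, ← Finset.sum_add_distrib]
            refine Finset.sum_congr rfl fun k _ ↦ ?_
            rw [← mul_div_assoc, ← mul_div_assoc, ← mul_div_assoc, ← add_div]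
            congr 1
            linear_combination (T (b k - c₃) * (m.map fun c ↦ T (b k - c)).prod) * split (b k)
        _ = 0 := by rw [h1, h2, mul_zero, mul_zero, add_zero]
    have hc := hT.differentiable.continuous
    have := eq_zero_of_eventually_punctured (p := 0)
      (f := fun t ↦ ∑ k ∈ S, T (b k - (a₁ + t)) * T (b k - a₂) *
        (T (b k - (a₃ - t)) * (m.map fun c ↦ T (b k - c)).prod) / ∏ j ∈ S.erase k, T (b k - b j))
      (Continuous.continuousAt (by fun_prop)) (by
        filter_upwards [hT.eventually_affine_ne_zero (neg_ne_zero.2 one_ne_zero)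
          (b p + b q - a₂ - a₁) 0] with t ht
        refine generic _ _ (by ring) ?_
        rwa [show b p + b q - a₂ - (a₁ + t) = b p + b q - a₂ - a₁ + -1 * t by ring])
    simpa only [Multiset.map_cons, Multiset.prod_cons, add_zero, sub_zero, mul_assoc] using this

/-- The commutation identity for a theta function with generic parameters `α`, `β`. -/
lemma sum_prod_comm_of_ne [Fintype ι] [Nonempty ι] {u : ι → ℂ} {α β : ℂ} (hα : T α ≠ 0)
    (hβ : T β ≠ 0) (hu : ∀ j k, j ≠ k → T (u k - u j) ≠ 0)
    (hu' : ∀ j k, T (u k - u j + (α + β)) ≠ 0) :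
    ∑ k, ∏ j ∈ Finset.univ.erase k, (T (u j - u k + α) * T (u j - u k + β)) /
        (T (u j - u k) * T (u j - u k + (α + β))) =
      ∑ k, ∏ j ∈ Finset.univ.erase k, (T (u k - u j + α) * T (u k - u j + β)) /
        (T (u k - u j) * T (u k - u j + (α + β))) := by
  obtain ⟨n, hn⟩ : ∃ n, Fintype.card ι = n + 1 := Nat.exists_eq_succ_of_ne_zero Fintype.card_ne_zero
  have hαβ : T (α + β) ≠ 0 := by
    obtain ⟨k⟩ := ‹Nonempty ι›
    simpa using hu' k k
  let b : ι ⊕ ι → ℂ := Sum.elim u fun j ↦ u j - (α + β)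
  have key := hT.sum_prod_div_prod_erase_eq_zero b (2 * n) Finset.univ
    (Finset.univ.val.map (fun j ↦ u j - α) + Finset.univ.val.map fun j ↦ u j - β)
    (by rw [Finset.card_univ, Fintype.card_sum]; lia)
    (by
      rw [Multiset.card_add, Multiset.card_map, Multiset.card_map, Finset.card_val,
        Finset.card_univ]
      lia)
    (by
      rw [Multiset.sum_add, Fintype.sum_sum_type]
      change ∑ j, (u j - α) + ∑ j, (u j - β) = ∑ j, u j + ∑ j, (u j - (α + β))
      simp only [Finset.sum_sub_distrib, Finset.sum_add_distrib]
      ring)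
    (by
      rintro (j | j) - (k | k) - hjk
      · exact hu j k fun h ↦ hjk (by rw [h])
      · change T (u k - (α + β) - u j) ≠ 0
        rw [show u k - (α + β) - u j = -(u j - u k + (α + β)) by ring, hT.odd]
        exact neg_ne_zero.2 (hu' k j)
      · change T (u k - (u j - (α + β))) ≠ 0
        rw [← sub_add]
        exact hu' j k
      · change T (u k - (α + β) - (u j - (α + β))) ≠ 0
        rw [sub_sub_sub_cancel_right]
        exact hu j k fun h ↦ hjk (by rw [h]))
  have erase_inl : ∀ k : ι, (Finset.univ : Finset (ι ⊕ ι)).erase (Sum.inl k) =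
      (Finset.univ.erase k).disjSum Finset.univ := fun k ↦ by ext (j | j) <;> simp
  have erase_inr : ∀ k : ι, (Finset.univ : Finset (ι ⊕ ι)).erase (Sum.inr k) =
      Finset.univ.disjSum (Finset.univ.erase k) := fun k ↦ by ext (j | j) <;> simp
  have num : ∀ z : ℂ, ((Finset.univ.val.map (fun j ↦ u j - α) +
      Finset.univ.val.map fun j ↦ u j - β).map fun c ↦ T (z - c)).prod =
      (∏ j, T (z - (u j - α))) * ∏ j, T (z - (u j - β)) := fun z ↦ by
    rw [Multiset.map_add, Multiset.prod_add, Multiset.map_map, Multiset.map_map]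
    rfl
  have term_inl : ∀ k : ι, ((∏ j, T (u k - (u j - α))) * ∏ j, T (u k - (u j - β))) /
      ((∏ j ∈ Finset.univ.erase k, T (u k - u j)) * ∏ j, T (u k - (u j - (α + β)))) =
      T α * T β / T (α + β) * ∏ j ∈ Finset.univ.erase k,
        (T (u k - u j + α) * T (u k - u j + β)) / (T (u k - u j) * T (u k - u j + (α + β))) := by
    intro k
    simp only [← sub_add]
    rw [← Finset.mul_prod_erase _ (fun j ↦ T (u k - u j + α)) (Finset.mem_univ k),
      ← Finset.mul_prod_erase _ (fun j ↦ T (u k - u j + β)) (Finset.mem_univ k),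
      ← Finset.mul_prod_erase _ (fun j ↦ T (u k - u j + (α + β))) (Finset.mem_univ k),
      Finset.prod_div_distrib, Finset.prod_mul_distrib, Finset.prod_mul_distrib]
    simp only [sub_self, zero_add]
    rw [div_mul_div_comm]
    congr 1 <;> ring
  have term_inr : ∀ k : ι, ((∏ j, T (u k - (α + β) - (u j - α))) *
      ∏ j, T (u k - (α + β) - (u j - β))) / ((∏ j, T (u k - (α + β) - u j)) *
        ∏ j ∈ Finset.univ.erase k, T (u k - (α + β) - (u j - (α + β)))) =
      -(T α * T β / T (α + β)) * ∏ j ∈ Finset.univ.erase k,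
        (T (u j - u k + α) * T (u j - u k + β)) / (T (u j - u k) * T (u j - u k + (α + β))) := by
    intro k
    have e1 : ∀ j, T (u k - (α + β) - (u j - α)) = -T (u j - u k + β) := fun j ↦ by
      rw [← hT.odd]; ring_nf
    have e2 : ∀ j, T (u k - (α + β) - (u j - β)) = -T (u j - u k + α) := fun j ↦ by
      rw [← hT.odd]; ring_nf
    have e3 : ∀ j, T (u k - (α + β) - u j) = -T (u j - u k + (α + β)) := fun j ↦ by
      rw [← hT.odd]; ring_nf
    have e4 : ∀ j, T (u k - (α + β) - (u j - (α + β))) = -T (u j - u k) := fun j ↦ by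
      rw [← hT.odd]; ring_nf
    simp only [e1, e2, e3, e4]
    rw [← Finset.mul_prod_erase _ (fun j ↦ -T (u j - u k + α)) (Finset.mem_univ k),
      ← Finset.mul_prod_erase _ (fun j ↦ -T (u j - u k + β)) (Finset.mem_univ k),
      ← Finset.mul_prod_erase _ (fun j ↦ -T (u j - u k + (α + β))) (Finset.mem_univ k)]
    simp only [sub_self, zero_add]
    rw [show ∀ A B C D E F G : ℂ, -A * B * (-C * D) / (-E * F * G) =
      -(C * A / E) * ((D * B) / (G * F)) from fun A B C D E F G ↦ by
        rw [neg_mul E, neg_mul (E * F), div_neg, neg_mul (C * A / E), div_mul_div_comm]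
        ring]
    rw [← Finset.prod_mul_distrib, ← Finset.prod_mul_distrib, ← Finset.prod_div_distrib]
    simp only [neg_mul_neg]
  simp only [num, Fintype.sum_sum_type, erase_inl, erase_inr, Finset.prod_disjSum, b,
    Sum.elim_inl, Sum.elim_inr, term_inl, term_inr] at key
  rw [← Finset.mul_sum, ← Finset.mul_sum, neg_mul, ← sub_eq_add_neg, ← mul_sub] at key
  exact (sub_eq_zero.1 ((mul_eq_zero.1 key).resolve_left
    (div_ne_zero (mul_ne_zero hα hβ) hαβ))).symm

/-- The commutation identity for a theta function. -/
lemma sum_prod_comm [Fintype ι] [Nonempty ι] {u : ι → ℂ} (α β : ℂ)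
    (hu : ∀ j k, j ≠ k → T (u k - u j) ≠ 0)
    (hu' : ∀ j k, j ≠ k → T (u k - u j + (α + β)) ≠ 0) :
    ∑ k, ∏ j ∈ Finset.univ.erase k, (T (u j - u k + α) * T (u j - u k + β)) /
        (T (u j - u k) * T (u j - u k + (α + β))) =
      ∑ k, ∏ j ∈ Finset.univ.erase k, (T (u k - u j + α) * T (u k - u j + β)) /
        (T (u k - u j) * T (u k - u j + (α + β))) := by
  have hc := hT.differentiable.continuous
  have cont : ∀ v : ι → ι → ℂ, (∀ j k, j ≠ k → T (v j k) ≠ 0) →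
      (∀ j k, j ≠ k → T (v j k + (α + β)) ≠ 0) → ContinuousAt (fun t ↦
        ∑ k, ∏ j ∈ Finset.univ.erase k, (T (v j k + (α + t)) * T (v j k + (β + t))) /
          (T (v j k) * T (v j k + ((α + t) + (β + t))))) 0 := by
    intro v hv hv'
    refine tendsto_finsetSum _ fun k _ ↦ tendsto_finsetProd _ fun j hj ↦ ?_
    have hjk := Finset.ne_of_mem_erase hj
    refine ContinuousAt.div (Continuous.continuousAt (by fun_prop))
      (Continuous.continuousAt (by fun_prop)) (mul_ne_zero (hv j k hjk) ?_)
    simpa using hv' j k hjk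
  have := eq_zero_of_eventually_punctured
    ((cont (fun j k ↦ u j - u k) (fun j k h ↦ hu k j h.symm) fun j k h ↦ hu' k j h.symm).sub
      (cont (fun j k ↦ u k - u j) hu hu')) (by
    filter_upwards [hT.eventually_affine_ne_zero one_ne_zero α 0,
      hT.eventually_affine_ne_zero one_ne_zero β 0, eventually_all.2 fun j ↦ eventually_all.2
        fun k ↦ hT.eventually_affine_ne_zero two_ne_zero (u k - u j + (α + β)) 0] with t h1 h2 h3
    rw [one_mul] at h1 h2
    refine sub_eq_zero.2 (hT.sum_prod_comm_of_ne h1 h2 hu fun j k ↦ ?_)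
    convert h3 j k using 2
    ring)
  simpa [sub_eq_zero] using this

end IsThetaFunction

section JacobiTheta

variable {x : ℝ} {s : ℂ}

lemma norm_xpow_lt_one (hx0 : 0 < x) (hx1 : x < 1) (hs : 0 < s.re) : ‖xpow x (2 * s)‖ < 1 := by
  rw [xpow, norm_exp, Real.exp_lt_one_iff, re_mul_ofReal]
  have := Real.log_neg hx0 hx1
  simp only [mul_re, re_ofNat, im_ofNat, zero_mul, sub_zero]
  nlinarith [mul_pos hs (neg_pos.2 this)]

lemma xpow_add (x : ℝ) (v w : ℂ) : xpow x (v + w) = xpow x v * xpow x w := by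
  rw [xpow, add_mul, exp_add]
  rfl

lemma xpow_neg (x : ℝ) (w : ℂ) : xpow x (-w) = (xpow x w)⁻¹ := by
  rw [xpow, neg_mul, exp_neg]
  rfl

lemma xpow_ne_zero (x : ℝ) (w : ℂ) : xpow x w ≠ 0 := exp_ne_zero _

lemma xpow_int_mul (x : ℝ) (k : ℤ) (w : ℂ) : xpow x (k * w) = xpow x w ^ k := by
  rw [xpow, mul_assoc, exp_int_mul]
  rfl

lemma jTheta_neg (hx0 : 0 < x) (hx1 : x < 1) (hs : 0 < s.re) (u : ℂ) :
    jTheta x s (-u) = -jTheta x s u := by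
  have hq := norm_xpow_lt_one hx0 hx1 hs
  unfold jTheta
  rw [mul_neg, xpow_neg, jacTheta0_inv hq (xpow_ne_zero _ _),
    show (-u) ^ 2 / s - -u = u ^ 2 / s - u + 2 * u by ring, xpow_add]
  have := xpow_ne_zero x (2 * u)
  generalize xpow x (2 * u) = w at *
  field_simp

lemma jTheta_add_period (hx0 : 0 < x) (hx1 : x < 1) (hs : 0 < s.re) (u : ℂ) :
    jTheta x s (u + s) = -jTheta x s u := by
  have hq := norm_xpow_lt_one hx0 hx1 hs
  have hs0 : s ≠ 0 := fun h ↦ by simp [h] at hs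
  unfold jTheta
  rw [mul_add, add_comm (2 * u), xpow_add x (2 * s),
    jacTheta0_mul_left hq (xpow_ne_zero _ _) (xpow_ne_zero _ _),
    show (u + s) ^ 2 / s - (u + s) = u ^ 2 / s - u + 2 * u by field_simp; ring, xpow_add]
  have := xpow_ne_zero x (2 * u)
  generalize xpow x (2 * u) = w at *
  field_simp

/-- The imaginary quasi-period of `jTheta x s`. -/
noncomputable def imagPeriod (x : ℝ) : ℂ := Real.pi * I / Real.log x

lemma jTheta_add_imagPeriod (hx0 : 0 < x) (hx1 : x < 1) (u : ℂ) :
    jTheta x s (u + imagPeriod x) =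
      xpow x (2 * imagPeriod x / s * u + (imagPeriod x ^ 2 / s - imagPeriod x)) *
        jTheta x s u := by
  have hL : (Real.log x : ℂ) ≠ 0 := ofReal_ne_zero.2 (Real.log_neg hx0 hx1).ne
  have h1 : xpow x (2 * imagPeriod x) = 1 := by
    rw [xpow, imagPeriod, mul_assoc, div_mul_cancel₀ _ hL, ← mul_assoc, exp_two_pi_mul_I]
  unfold jTheta
  rw [mul_add, xpow_add x (2 * u), h1, mul_one,
    show (u + imagPeriod x) ^ 2 / s - (u + imagPeriod x) =
      2 * imagPeriod x / s * u + (imagPeriod x ^ 2 / s - imagPeriod x) + (u ^ 2 / s - u) by ring,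
    xpow_add]
  ring

lemma exists_of_jTheta_eq_zero (hx0 : 0 < x) (hx1 : x < 1) (hs : 0 < s.re) {l : ℂ}
    (h : jTheta x s l = 0) : ∃ k m : ℤ, l = k * s + m * imagPeriod x := by
  have hq := norm_xpow_lt_one hx0 hx1 hs
  have hL : (Real.log x : ℂ) ≠ 0 := ofReal_ne_zero.2 (Real.log_neg hx0 hx1).ne
  rw [jTheta, div_eq_zero_iff, or_iff_left (pow_ne_zero _ (qPoch_self_ne_zero hq)), mul_eq_zero,
    or_iff_right (xpow_ne_zero _ _)] at h
  obtain ⟨k, hk⟩ := exists_zpow_of_jacTheta0_eq_zero hq (xpow_ne_zero _ _) h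
  rw [← xpow_int_mul, xpow, xpow, exp_eq_exp_iff_exists_int] at hk
  obtain ⟨m, hm⟩ := hk
  refine ⟨k, m, mul_right_cancel₀ hL ?_⟩
  rw [add_mul, imagPeriod, mul_assoc (m : ℂ), div_mul_cancel₀ _ hL]
  linear_combination hm / 2

/-- The quasi-periods of a function form a subgroup. -/
def quasiperiodSubgroup (T : ℂ → ℂ) : AddSubgroup ℂ where
  carrier := {l | ∃ c d : ℂ, ∀ u, T (u + l) = exp (c * u + d) * T u}
  zero_mem' := ⟨0, 0, fun u ↦ by simp⟩
  add_mem' := by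
    rintro l l' ⟨c, d, h⟩ ⟨c', d', h'⟩
    refine ⟨c + c', c' * l + d + d', fun u ↦ ?_⟩
    rw [← add_assoc, h', h, ← mul_assoc, ← exp_add]
    ring_nf
  neg_mem' := by
    rintro l ⟨c, d, h⟩
    refine ⟨-c, c * l - d, fun u ↦ ?_⟩
    have := h (u + -l)
    rw [neg_add_cancel_right] at this
    rw [this, ← mul_assoc, ← exp_add, show -c * u + (c * l - d) + (c * (u + -l) + d) = 0 by ring,
      exp_zero, one_mul]

lemma mem_quasiperiodSubgroup_jTheta (hx0 : 0 < x) (hx1 : x < 1) (hs : 0 < s.re) (k m : ℤ) :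
    k * s + m * imagPeriod x ∈ quasiperiodSubgroup (jTheta x s) := by
  have h1 : s ∈ quasiperiodSubgroup (jTheta x s) :=
    ⟨0, Real.pi * I, fun u ↦ by rw [jTheta_add_period hx0 hx1 hs, zero_mul, zero_add, exp_pi_mul_I,
      neg_one_mul]⟩
  have h2 : imagPeriod x ∈ quasiperiodSubgroup (jTheta x s) :=
    ⟨2 * imagPeriod x / s * Real.log x, (imagPeriod x ^ 2 / s - imagPeriod x) * Real.log x,
      fun u ↦ by
        rw [jTheta_add_imagPeriod hx0 hx1, xpow]
        ring_nf⟩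
  simpa only [zsmul_eq_mul] using add_mem (zsmul_mem h1 k) (zsmul_mem h2 m)

lemma isThetaFunction_jTheta (hx0 : 0 < x) (hx1 : x < 1) (hs : 0 < s.re) :
    IsThetaFunction (jTheta x s) := by
  have hq := norm_xpow_lt_one hx0 hx1 hs
  have hL0 := Real.log_neg hx0 hx1
  have hL : (Real.log x : ℂ) ≠ 0 := ofReal_ne_zero.2 hL0.ne
  have hxd : Differentiable ℂ (xpow x) := fun w ↦ by unfold xpow; fun_prop
  have hP := differentiable_qPoch hq
  set q := xpow x (2 * s) with hqdef
  let K : ℂ → ℂ := fun u ↦ xpow x (u ^ 2 / s - u) * (qPoch (q * xpow x (2 * u)) q *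
    qPoch (q * xpow x (-(2 * u))) q * qPoch q q) / qPoch q q ^ 3
  have hfac : jTheta x s = fun u ↦ (1 - xpow x (2 * u)) * K u := by
    funext u
    simp only [K, jTheta, jacTheta0, ← hqdef]
    rw [qPoch_eq_mul hq (xpow x (2 * u)), xpow_neg]
    ring
  have hKd : Differentiable ℂ K := by
    have hA : Differentiable ℂ fun u : ℂ ↦ qPoch (q * xpow x (2 * u)) q :=
      hP.comp (f := fun u : ℂ ↦ q * xpow x (2 * u)) (by fun_prop)
    have hB : Differentiable ℂ fun u : ℂ ↦ qPoch (q * xpow x (-(2 * u))) q :=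
      hP.comp (f := fun u : ℂ ↦ q * xpow x (-(2 * u))) (by fun_prop)
    have hC : Differentiable ℂ fun u : ℂ ↦ xpow x (u ^ 2 / s - u) :=
      hxd.comp (f := fun u : ℂ ↦ u ^ 2 / s - u) (by fun_prop)
    exact (hC.mul ((hA.mul hB).mul_const _)).div_const _
  have hxpow0 : xpow x 0 = 1 := by simp [xpow]
  have hzero : jTheta x s 0 = 0 := by simp [hfac, hxpow0]
  refine ⟨?_, jTheta_neg hx0 hx1 hs, ?_, fun l hl ↦ ?_, s, imagPeriod x, fun k m ↦ ?_, fun z ↦ ?_⟩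
  · rw [hfac]
    fun_prop
  · have h1 : HasDerivAt (fun u : ℂ ↦ 1 - xpow x (2 * u)) (-(2 * Real.log x)) 0 := by
      have := ((((hasDerivAt_id (0 : ℂ)).const_mul 2).mul_const (Real.log x : ℂ)).cexp).const_sub 1
      simpa [xpow] using this
    have h2 := h1.mul (hKd 0).hasDerivAt
    rw [hfac]
    refine ne_of_eq_of_ne h2.deriv ?_
    have hQ := qPoch_self_ne_zero hq
    simp [hxpow0, K, hQ, hL]
  · obtain ⟨k, m, rfl⟩ := exists_of_jTheta_eq_zero hx0 hx1 hs hl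
    exact mem_quasiperiodSubgroup_jTheta hx0 hx1 hs k m
  · obtain ⟨c, d, h⟩ := mem_quasiperiodSubgroup_jTheta hx0 hx1 hs k m
    have := h 0
    rwa [hzero, mul_zero, zero_add] at this
  · have hω : imagPeriod x = ((Real.pi / Real.log x : ℝ) : ℂ) * I := by
      rw [imagPeriod]
      push_cast
      ring
    have hπ := Real.pi_ne_zero
    refine ⟨z.re / s.re, (z.im - z.re / s.re * s.im) / (Real.pi / Real.log x), ?_⟩
    rw [hω, ← mul_assoc, ← ofReal_mul, div_mul_cancel₀ _ (div_ne_zero hπ hL0.ne)]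
    apply Complex.ext
    · rw [add_re, re_ofReal_mul, re_ofReal_mul, I_re, mul_zero, add_zero,
        div_mul_cancel₀ _ hs.ne']
    · rw [add_im, im_ofReal_mul, im_ofReal_mul, I_im]
      ring

end JacobiTheta

open Finset in
theorem stmt13 (x : ℝ) (hx0 : 0 < x) (hx1 : x < 1) (s : ℂ) (hs : 0 < s.re) (r : ℂ)
    (n : ℕ) (hn : 1 ≤ n) (u : Fin (n + 1) → ℂ)
    (h1 : ∀ j k : Fin (n + 1), j ≠ k → jTheta x s (u k - u j) ≠ 0)
    (h2 : ∀ j k : Fin (n + 1), j ≠ k → jTheta x s (u k - u j + r) ≠ 0) :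
    ∑ k : Fin (n + 1), ∏ j ∈ univ.erase k,
        (jTheta x s (u j - u k + 1) * jTheta x s (u j - u k + (r - 1))) /
          (jTheta x s (u j - u k) * jTheta x s (u j - u k + r)) =
    ∑ k : Fin (n + 1), ∏ j ∈ univ.erase k,
        (jTheta x s (u k - u j + 1) * jTheta x s (u k - u j + (r - 1))) /
          (jTheta x s (u k - u j) * jTheta x s (u k - u j + r)) := by
  have hT := isThetaFunction_jTheta hx0 hx1 hs
  have hr : 1 + (r - 1) = r := by ring
  have := hT.sum_prod_comm (u := u) 1 (r - 1) h1 (by rwa [hr])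
  rwa [hr] at this
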